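/- arXiv:2111.05996 — 2 statements merged into one kernel-verified Lean document; each statement's English description precedes it below -/
import Mathlib

section
/- Let n > 0 be an even integer. Then δ(n+1) = δ(n) + (⌊log₂ n⌋ − 2·s₁(n) + 2), as an identity of integers. -/
/-- Number of D-nodes in the divide-and-conquer tree on `n` leaves:
`δ(1) = 0`, `δ(2m) = 2·δ(m)`, `δ(2m+1) = δ(m) + δ(m+1) + 1`. -/
def delta : ℕ → ℕ
  | 0 => 0
  | 1 => 0
  | n + 2 =>
    if (n + 2) % 2 = 0 then 2 * delta ((n + 2) / 2)
    else delta ((n + 2) / 2) + delta ((n + 2) / 2 + 1) + 1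
decreasing_by all_goals (simp_wf; omega)

/-- Hamming weight of `n`: number of 1s in the binary expansion of `n`. -/
def s1 (n : ℕ) : ℕ := (Nat.digits 2 n).sum

theorem delta_two_mul (m : ℕ) : delta (2 * m) = 2 * delta m := by
  rcases m with _ | m
  · simp [delta]
  · rw [show 2 * (m + 1) = 2 * m + 2 by ring, delta, if_pos (by omega),
      show (2 * m + 2) / 2 = m + 1 by omega]

theorem delta_two_mul_add_one {m : ℕ} (hm : 0 < m) :
    delta (2 * m + 1) = delta m + delta (m + 1) + 1 := by
  obtain ⟨k, rfl⟩ := Nat.exists_eq_succ_of_ne_zero hm.ne'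
  rw [show 2 * k.succ + 1 = 2 * k + 1 + 2 by omega, delta, if_neg (by omega),
    show (2 * k + 1 + 2) / 2 = k.succ by omega]

theorem s1_two_mul (m : ℕ) : s1 (2 * m) = s1 m := by
  rcases m.eq_zero_or_pos with rfl | hm
  · simp
  · simp [s1, Nat.digits_def' one_lt_two (show 0 < 2 * m by omega)]

theorem s1_two_mul_add_one (m : ℕ) : s1 (2 * m + 1) = s1 m + 1 := by
  rw [s1, s1, Nat.digits_def' one_lt_two (Nat.succ_pos _), List.sum_cons,
    show (2 * m + 1) % 2 = 1 by omega, show (2 * m + 1) / 2 = m by omega, add_comm]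

theorem log_two_of_div_two_eq {m n : ℕ} (hm : 0 < m) (h : n / 2 = m) :
    Nat.log 2 n = Nat.log 2 m + 1 := by
  rw [Nat.log_of_one_lt_of_le one_lt_two (by omega), h]

/-- The increment formula for `delta`, which holds without any parity assumption. -/
theorem delta_succ {n : ℕ} (hn : 0 < n) :
    (delta (n + 1) : ℤ) = (delta n : ℤ) + ((Nat.log 2 n : ℤ) - 2 * (s1 n : ℤ) + 2) := by
  induction n using Nat.strong_induction_on with
  | _ n ih =>
    obtain ⟨m, rfl | rfl⟩ := Nat.even_or_odd' n
    · have hm : 0 < m := by omega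
      have := ih m (by omega) hm
      rw [delta_two_mul_add_one hm, delta_two_mul, s1_two_mul,
        log_two_of_div_two_eq (n := 2 * m) hm (by omega)]
      push_cast
      linarith
    · rcases m.eq_zero_or_pos with rfl | hm
      · simp [delta, s1]
      · have := ih m (by omega) hm
        rw [show 2 * m + 1 + 1 = 2 * (m + 1) by ring, delta_two_mul, delta_two_mul_add_one hm,
          s1_two_mul_add_one, log_two_of_div_two_eq (n := 2 * m + 1) hm (by omega)]
        push_cast
        linarith

theorem delta_succ_of_even (n : ℕ) (hn : 0 < n) (he : Even n) :
    (delta (n + 1) : ℤ) = (delta n : ℤ) + ((Nat.log 2 n : ℤ) - 2 * (s1 n : ℤ) + 2) := by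
  exact delta_succ hn
end

section
/- Let k ≥ 0, let r be an integer with 0 ≤ r < 2^k, and set n = 2^k + r. Then s₁(n) = 2^{k−1}·[τ(r/2^k) − τ((r+1)/2^k)] + (k+2)/2, as real numbers. -/
/-- The Takagi function `τ(x) = ∑_{i=0}^∞ dist(2^i·x, ℤ) / 2^i`, where the distance from
`y` to the nearest integer is `|y - round y|`. -/
noncomputable def takagi (x : ℝ) : ℝ := ∑' i : ℕ, |2 ^ i * x - round (2 ^ i * x)| / 2 ^ i

theorem s1_eq_mod_add_div (n : ℕ) : s1 n = n % 2 + s1 (n / 2) := by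
  rcases Nat.eq_zero_or_pos n with rfl | hn
  · simp [s1]
  · simp [s1, Nat.digits_def' one_lt_two hn]

theorem s1_two_pow_add (k r : ℕ) (hr : r < 2 ^ k) : s1 (2 ^ k + r) = 1 + s1 r := by
  induction k generalizing r with
  | zero =>
    obtain rfl : r = 0 := by simpa using hr
    simp [s1]
  | succ k ih =>
    rw [pow_succ] at hr ⊢
    rw [s1_eq_mod_add_div, s1_eq_mod_add_div r]
    have hmod : (2 ^ k * 2 + r) % 2 = r % 2 := by omega
    have hdiv : (2 ^ k * 2 + r) / 2 = 2 ^ k + r / 2 := by omega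
    rw [hmod, hdiv, ih (r / 2) (by omega)]
    omega

theorem summable_takagi (x : ℝ) :
    Summable fun i : ℕ => |2 ^ i * x - round (2 ^ i * x)| / (2 : ℝ) ^ i := by
  refine Summable.of_nonneg_of_le (fun i => by positivity) (fun i => ?_)
    summable_geometric_two
  rw [one_div, inv_pow, div_eq_mul_inv]
  have := abs_sub_round (2 ^ i * x)
  exact mul_le_of_le_one_left (by positivity) (by linarith)

theorem takagi_eq_add_half (x : ℝ) : takagi x = |x - round x| + takagi (2 * x) / 2 := by
  rw [takagi, (summable_takagi x).tsum_eq_zero_add, takagi, ← tsum_div_const]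
  congr 1
  · simp
  · refine tsum_congr fun i => ?_
    rw [pow_succ, mul_assoc, div_div]

theorem takagi_add_one (x : ℝ) : takagi (x + 1) = takagi x := by
  refine tsum_congr fun i => ?_
  have h : (2 : ℝ) ^ i * (x + 1) = 2 ^ i * x + ((2 ^ i : ℤ) : ℝ) := by push_cast; ring
  rw [h, round_add_intCast]
  push_cast
  rw [add_sub_add_right_eq_sub]

theorem abs_sub_round_of_le_half {x : ℝ} (h₀ : 0 ≤ x) (h : x ≤ 1 / 2) : |x - round x| = x := by
  rw [abs_sub_round_eq_min, Int.fract_eq_self.2 ⟨h₀, by linarith⟩, min_eq_left (by linarith)]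

theorem abs_sub_round_of_half_le {x : ℝ} (h : 1 / 2 ≤ x) (h₁ : x ≤ 1) :
    |x - round x| = 1 - x := by
  rcases h₁.eq_or_lt with rfl | h₁
  · simp
  · rw [abs_sub_round_eq_min, Int.fract_eq_self.2 ⟨by linarith, h₁⟩, min_eq_right (by linarith)]

theorem s1_eq_takagi_diff (k r : ℕ) (hr : r < 2 ^ k) :
    (s1 (2 ^ k + r) : ℝ) =
      (2 : ℝ) ^ ((k : ℤ) - 1) *
        (takagi ((r : ℝ) / 2 ^ k) - takagi (((r : ℝ) + 1) / 2 ^ k)) +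
        ((k : ℝ) + 2) / 2 := by
  rw [zpow_sub_one₀ two_ne_zero, zpow_natCast]
  induction k generalizing r with
  | zero =>
    obtain rfl : r = 0 := by simpa using hr
    have h := takagi_add_one 0
    rw [zero_add] at h
    simp [s1, h]
  | succ k ih =>
    have hpos : (0 : ℝ) < 2 ^ k := by positivity
    have hdouble (y : ℝ) : 2 * (y / 2 ^ (k + 1)) = y / 2 ^ k := by
      rw [pow_succ]; field_simp
    rw [takagi_eq_add_half ((r : ℝ) / 2 ^ (k + 1)),
      takagi_eq_add_half (((r : ℝ) + 1) / 2 ^ (k + 1)), hdouble, hdouble, s1_two_pow_add _ _ hr]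
    rcases lt_or_ge r (2 ^ k) with h | h
    · have hle : (r : ℝ) + 1 ≤ 2 ^ k := by exact_mod_cast h
      have ih := ih r h
      rw [s1_two_pow_add _ _ h] at ih
      have hhalf {y : ℝ} (hy : y ≤ 2 ^ k) : y / 2 ^ (k + 1) ≤ 1 / 2 := by
        rw [div_le_div_iff₀ (by positivity) two_pos, pow_succ]; linarith
      rw [ih, abs_sub_round_of_le_half (by positivity) (hhalf (by linarith)),
        abs_sub_round_of_le_half (by positivity) (hhalf hle)]
      push_cast
      field_simp
      ring
    · obtain ⟨q, rfl⟩ := Nat.exists_eq_add_of_le h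
      have hq : q < 2 ^ k := by rw [pow_succ] at hr; omega
      have hle : (q : ℝ) + 1 ≤ 2 ^ k := by exact_mod_cast hq
      have hq₀ : (0 : ℝ) ≤ q := q.cast_nonneg
      have hhalf {y : ℝ} (hy : 2 ^ k ≤ y) : 1 / 2 ≤ y / 2 ^ (k + 1) := by
        rw [div_le_div_iff₀ two_pos (by positivity), pow_succ]; linarith
      have hone {y : ℝ} (hy : y ≤ 2 ^ k + 2 ^ k) : y / 2 ^ (k + 1) ≤ 1 := by
        rw [div_le_one (by positivity), pow_succ]; linarith
      have hshift (y : ℝ) : takagi ((2 ^ k + y) / 2 ^ k) = takagi (y / 2 ^ k) := by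
        rw [← takagi_add_one (y / 2 ^ k), add_div, div_self hpos.ne', add_comm]
      push_cast
      rw [ih q hq, abs_sub_round_of_half_le (hhalf (by linarith)) (hone (by linarith)),
        abs_sub_round_of_half_le (hhalf (by linarith)) (hone (by linarith)),
        add_assoc, hshift, hshift]
      field_simp
      ring
end
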